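/- Let f(w_1,…,w_L) = Σ_{l,k=1}^L c_{lk} g(w_l^T Σ_{lk} w_k) be the RGCCA objective and let ∇_l f(w) denote its partial gradient with respect to w_l. Then for every w = (w_1,…,w_L) with w_k ∈ ℝ^{p_k} and every w̃_l ∈ ℝ^{p_l}, one has f(w_1,…,w_{l−1}, w̃_l, w_{l+1},…,w_L) ≥ f(w) + ∇_l f(w)^T (w̃_l − w_l). -/

import Mathlib

open Matrix
open scoped RealInnerProductSpace

/-- A convex function lies above its tangent hyperplane at any point of differentiability. -/
theorem ConvexOn.add_inner_le_of_hasGradientAt {E : Type*} [NormedAddCommGroup E]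
    [InnerProductSpace ℝ E] [CompleteSpace E] {F : E → ℝ} (hF : ConvexOn ℝ Set.univ F)
    {x G : E} (hG : HasGradientAt F G x) (y : E) :
    F x + ⟪G, y - x⟫ ≤ F y := by
  have hconv : ConvexOn ℝ Set.univ (F ∘ AffineMap.lineMap (k := ℝ) x y) := by
    simpa using hF.comp_affineMap (AffineMap.lineMap (k := ℝ) x y)
  have hderiv : HasDerivAt (F ∘ AffineMap.lineMap (k := ℝ) x y) ⟪G, y - x⟫ 0 := by
    have hG' : HasFDerivAt F (InnerProductSpace.toDual ℝ E G)
        (AffineMap.lineMap (k := ℝ) x y (0 : ℝ)) := by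
      simpa using hG.hasFDerivAt
    simpa using hG'.comp_hasDerivAt (0 : ℝ) AffineMap.hasDerivAt_lineMap
  have hslope := hconv.le_slope_of_hasDerivAt (Set.mem_univ 0) (Set.mem_univ 1)
    one_pos hderiv
  simp [slope_def_field] at hslope
  linarith

/-- The quadratic form of a positive semidefinite real matrix is convex. -/
theorem Matrix.PosSemidef.convexOn_dotProduct_mulVec {n : Type*} [Fintype n]
    {A : Matrix n n ℝ} (hA : A.PosSemidef) :
    ConvexOn ℝ Set.univ (fun v : n → ℝ => v ⬝ᵥ (A *ᵥ v)) := by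
  refine ⟨convex_univ, fun x _ y _ a b ha hb hab => ?_⟩
  have hnonneg : 0 ≤ (x - y) ⬝ᵥ (A *ᵥ (x - y)) := by
    simpa using hA.dotProduct_mulVec_nonneg (x - y)
  have hab_nonneg := mul_nonneg (mul_nonneg ha hb) hnonneg
  obtain rfl : b = 1 - a := by linarith
  simp only [mulVec_add, mulVec_sub, mulVec_smul, dotProduct_add, add_dotProduct,
    dotProduct_sub, sub_dotProduct, dotProduct_smul, smul_dotProduct, smul_eq_mul]
    at hab_nonneg ⊢
  linarith

/-- A convex differentiable function that is nondecreasing on the nonnegative reals, composed with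
a block-bilinear form, is convex in each block when the diagonal blocks are positive semidefinite. -/
theorem convexOn_comp_update_dotProduct_mulVec {ι : Type*} [DecidableEq ι] (p : ι → ℕ)
    (S : ∀ i k, Matrix (Fin (p i)) (Fin (p k)) ℝ) (hS : ∀ i, (S i i).PosSemidef)
    {g : ℝ → ℝ} (hg : ConvexOn ℝ Set.univ g) (hg_mono : MonotoneOn g (Set.Ici 0))
    (w : ∀ k, EuclideanSpace ℝ (Fin (p k))) (l i k : ι) :
    ConvexOn ℝ Set.univ (fun v : EuclideanSpace ℝ (Fin (p l)) =>
      g (Function.update w l v i ⬝ᵥ (S i k *ᵥ Function.update w l v k))) := by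
  refine ⟨convex_univ, fun x _ y _ a b ha hb hab => ?_⟩
  have hg_le (s t : ℝ) := hg.2 (Set.mem_univ s) (Set.mem_univ t) ha hb hab
  by_cases hi : i = l
  · subst hi
    by_cases hk : k = i
    · subst hk
      have hnonneg (v : Fin (p k) → ℝ) : 0 ≤ v ⬝ᵥ (S k k *ᵥ v) := by
        simpa using (hS k).dotProduct_mulVec_nonneg v
      have hquad := (hS k).convexOn_dotProduct_mulVec.2 (Set.mem_univ x.ofLp)
        (Set.mem_univ y.ofLp) ha hb hab
      simp only [Function.update_self]
      exact (hg_mono (hnonneg _) ((hnonneg _).trans hquad) hquad).trans (hg_le _ _)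
    · simp only [Function.update_self, Function.update_of_ne hk]
      refine le_of_eq_of_le ?_ (hg_le _ _)
      simp [add_dotProduct, smul_dotProduct]
  · by_cases hk : k = l
    · subst hk
      simp only [Function.update_self, Function.update_of_ne hi]
      refine le_of_eq_of_le ?_ (hg_le _ _)
      simp [mulVec_add, mulVec_smul, dotProduct_add, dotProduct_smul]
    · simp only [Function.update_of_ne hi, Function.update_of_ne hk]
      refine le_of_eq_of_le ?_ (hg_le _ _)
      rw [← add_smul, hab, one_smul]

/-- The RGCCA objective lies above its linear approximation in each block:
`f(w₁,…,w̃_l,…,w_L) ≥ f(w) + ⟪∇_l f(w), w̃_l - w_l⟫`. -/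
theorem rgcca_objective_above_linear_approx {L : ℕ} (p : Fin L → ℕ)
    (c : Fin L → Fin L → ℝ)
    (hc_nonneg : ∀ l k, 0 ≤ c l k) (hc_symm : ∀ l k, c l k = c k l)
    (S : ∀ l k, Matrix (Fin (p l)) (Fin (p k)) ℝ)
    (hS_symm : ∀ l k, S k l = (S l k)ᵀ)
    (hS_psd : ∀ l, (S l l).PosSemidef)
    (g : ℝ → ℝ) (hg_conv : ConvexOn ℝ Set.univ g)
    (hg_diff : Differentiable ℝ g)
    (hg' : ∀ x : ℝ, 0 ≤ x → 0 ≤ deriv g x)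
    (w : ∀ k, EuclideanSpace ℝ (Fin (p k))) (l : Fin L)
    (G : EuclideanSpace ℝ (Fin (p l)))
    (hG : HasGradientAt (fun v : EuclideanSpace ℝ (Fin (p l)) =>
        ∑ i, ∑ k, c i k *
          g (Function.update w l v i ⬝ᵥ (S i k *ᵥ Function.update w l v k)))
      G (w l))
    (wt : EuclideanSpace ℝ (Fin (p l))) :
    (∑ i, ∑ k, c i k *
        g (Function.update w l wt i ⬝ᵥ (S i k *ᵥ Function.update w l wt k)))
      ≥ (∑ i, ∑ k, c i k * g (w i ⬝ᵥ (S i k *ᵥ w k))) + ⟪G, wt - w l⟫ := by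
  have hg_mono : MonotoneOn g (Set.Ici 0) := by
    refine monotoneOn_of_deriv_nonneg (convex_Ici 0) hg_diff.continuous.continuousOn
      hg_diff.differentiableOn fun x hx => hg' x ?_
    exact interior_subset hx
  have hterm (i k : Fin L) :=
    (convexOn_comp_update_dotProduct_mulVec p S hS_psd hg_conv hg_mono w l i k).smul
      (hc_nonneg i k)
  have hF : ConvexOn ℝ Set.univ (fun v : EuclideanSpace ℝ (Fin (p l)) =>
      ∑ i, ∑ k, c i k *
        g (Function.update w l v i ⬝ᵥ (S i k *ᵥ Function.update w l v k))) := by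
    refine ⟨convex_univ, fun x hx y hy a b ha hb hab => ?_⟩
    simp only [Finset.smul_sum, ← Finset.sum_add_distrib]
    exact Finset.sum_le_sum fun i _ => Finset.sum_le_sum fun k _ =>
      (hterm i k).2 hx hy ha hb hab
  simpa only [Function.update_eq_self] using hF.add_inner_le_of_hasGradientAt hG wt
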